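/- For every dominant weight μ ∈ P⁺ and every positive root β ∈ Σ₀⁺ one has the moment gap estimates 2πμ(β∨)/(1 + h_k/n) ≤ μ̂_k(β∨) ≤ 2πμ(β∨), where h_k = 2·Σ_{α∈Σ₀} 1/k_α and n = dim V. -/

import Mathlib

open scoped BigOperators
open RealInnerProductSpace

noncomputable section

/-- The coroot `α∨` of a root `α`, under the identification of `V*` with `V`
via the inner product: `ξ(α∨) = 2⟨ξ,α⟩/‖α‖²`. -/
def coroot {V : Type*} [NormedAddCommGroup V] [InnerProductSpace ℝ V] (α : V) : V :=
  (2 / ‖α‖ ^ 2) • α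

/-- The orthogonal reflection `s_α` in the hyperplane orthogonal to `α`:
`s_α(ξ) = ξ − ξ(α∨)·α = ξ − α(ξ)·α∨`. -/
def sRefl {V : Type*} [NormedAddCommGroup V] [InnerProductSpace ℝ V] (α v : V) : V :=
  v - ⟪α, v⟫ • coroot α

/-- A finite, irreducible, reduced, crystallographic root system `Σ₀` in the dual of
the Euclidean space `V` (identified with `V` via the inner product), together with a
fixed base of simple roots, the positive roots, and the highest root. -/
structure RootSystemBase (V : Type*) [NormedAddCommGroup V] [InnerProductSpace ℝ V]
    [FiniteDimensional ℝ V] where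
  roots : Finset V
  roots_nonempty : roots.Nonempty
  ne_zero : ∀ α ∈ roots, α ≠ (0 : V)
  /-- reduced -/
  reduced : ∀ α ∈ roots, ∀ c : ℝ, c • α ∈ roots → c = 1 ∨ c = -1
  /-- crystallographic: `β(α∨) ∈ ℤ` -/
  crystallographic : ∀ α ∈ roots, ∀ β ∈ roots, ∃ m : ℤ, ⟪β, coroot α⟫ = (m : ℝ)
  /-- stable under the reflections `s_α` -/
  refl_mem : ∀ α ∈ roots, ∀ β ∈ roots, sRefl α β ∈ roots
  /-- `Σ₀` spans `V*` -/
  spanning : Submodule.span ℝ (roots : Set V) = ⊤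
  /-- irreducible: no nontrivial orthogonal decomposition -/
  irreducible : ∀ s : Finset V, s ⊆ roots →
    (∀ α ∈ s, ∀ β ∈ roots, β ∉ s → ⟪α, β⟫ = 0) → s = ∅ ∨ s = roots
  /-- the fixed base of simple roots -/
  simples : Finset V
  simples_sub : simples ⊆ roots
  simples_indep : LinearIndependent ℝ (fun β : {x // x ∈ simples} => (β : V))
  /-- the positive roots w.r.t. the base -/
  pos : Finset V
  pos_sub : pos ⊆ roots
  simples_sub_pos : simples ⊆ pos
  pos_or_neg : ∀ α ∈ roots, (α ∈ pos ∧ -α ∉ pos) ∨ (α ∉ pos ∧ -α ∈ pos)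
  pos_combo : ∀ α ∈ pos, ∃ c : V → ℝ, (∀ β, 0 ≤ c β) ∧ α = ∑ β ∈ simples, c β • β
  /-- the highest root `φ` -/
  hroot : V
  hroot_pos : hroot ∈ pos
  hroot_highest : ∀ α ∈ roots, ∃ c : V → ℝ, (∀ β, 0 ≤ c β) ∧
    hroot - α = ∑ β ∈ simples, c β • β

variable {V : Type*} [NormedAddCommGroup V] [InnerProductSpace ℝ V] [FiniteDimensional ℝ V]

/-- The Weyl group `W₀`: the subgroup of linear automorphisms of `V` generated by the
orthogonal reflections in the roots. -/
def weylGroup (R : RootSystemBase V) : Subgroup (V ≃ₗ[ℝ] V) :=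
  Subgroup.closure {w : V ≃ₗ[ℝ] V | ∃ α ∈ R.roots, ∀ v, w v = sRefl α v}

/-- A strictly positive `W₀`-invariant multiplicity function. -/
def IsMultiplicity (R : RootSystemBase V) (k : V → ℝ) : Prop :=
  (∀ α ∈ R.roots, 0 < k α) ∧
  (∀ w : V ≃ₗ[ℝ] V, w ∈ weylGroup R → ∀ α ∈ R.roots, k (w α) = k α)

/-- `σ_η^k = Σ_{α∈Σ₀} arctan(η(α∨)/k_α)·α`. -/
def sigmaFun (R : RootSystemBase V) (k : V → ℝ) (η : V) : V :=
  ∑ α ∈ R.roots, Real.arctan (⟪η, coroot α⟫ / k α) • α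

/-- The master function
`S_k(μ,ξ) = ½‖ξ‖² − 2π⟨μ,ξ⟩ + ½ Σ_{α∈Σ₀} ‖α‖² ∫₀^{ξ(α∨)} arctan(t/k_α) dt`. -/
def masterFun (R : RootSystemBase V) (k : V → ℝ) (μ ξ : V) : ℝ :=
  ‖ξ‖ ^ 2 / 2 - 2 * Real.pi * ⟪μ, ξ⟫ +
    (1 / 2) * ∑ α ∈ R.roots, ‖α‖ ^ 2 * ∫ t in (0:ℝ)..(⟪ξ, coroot α⟫), Real.arctan (t / k α)

/-- Membership in the weight lattice `P = {λ ∈ V* : λ(α∨) ∈ ℤ ∀α ∈ Σ₀}`. -/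
def IsWeight (R : RootSystemBase V) (lam : V) : Prop :=
  ∀ α ∈ R.roots, ∃ m : ℤ, ⟪lam, coroot α⟫ = (m : ℝ)

/-- `η ∈ V*` is a Bethe root: `λ = iη` solves the Bethe ansatz equations
`e^{(wλ)(φ∨)} = ∏_{α∈Σ₀⁺} ((wλ)(α∨) − k_α)/((wλ)(α∨) + k_α))^{α(φ∨)}` for all `w ∈ W₀`,
where `m α = α(φ∨) ∈ ℤ≥0`. -/
def IsBetheRoot (R : RootSystemBase V) (k : V → ℝ) (m : V → ℕ) (η : V) : Prop :=
  ∀ w : V ≃ₗ[ℝ] V, w ∈ weylGroup R →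
    Complex.exp (Complex.I * (⟪w η, coroot R.hroot⟫ : ℝ)) =
      ∏ α ∈ R.pos,
        ((Complex.I * (⟪w η, coroot α⟫ : ℝ) - (k α : ℂ)) /
         (Complex.I * (⟪w η, coroot α⟫ : ℝ) + (k α : ℂ))) ^ (m α)

end

noncomputable section

section reflections

variable {V : Type*} [NormedAddCommGroup V] [InnerProductSpace ℝ V]

theorem inner_coroot (ξ α : V) : ⟪ξ, coroot α⟫ = 2 / ‖α‖ ^ 2 * ⟪ξ, α⟫ := by
  rw [coroot, inner_smul_right]

theorem inner_self_coroot {α : V} (hα : α ≠ 0) : ⟪α, coroot α⟫ = 2 := by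
  have : ‖α‖ ≠ 0 := norm_ne_zero_iff.mpr hα
  rw [inner_coroot, real_inner_self_eq_norm_sq]
  field_simp

theorem inner_sRefl_sRefl {α : V} (hα : α ≠ 0) (x y : V) :
    ⟪sRefl α x, sRefl α y⟫ = ⟪x, y⟫ := by
  have : ‖α‖ ≠ 0 := norm_ne_zero_iff.mpr hα
  simp only [sRefl, coroot, inner_sub_left, inner_sub_right, inner_smul_left, inner_smul_right,
    real_inner_self_eq_norm_sq, real_inner_comm α x]
  simp only [conj_trivial]
  field_simp
  ring

theorem norm_sRefl {α : V} (hα : α ≠ 0) (x : V) : ‖sRefl α x‖ = ‖x‖ := by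
  have h := inner_sRefl_sRefl hα x x
  simp only [real_inner_self_eq_norm_sq] at h
  exact (sq_eq_sq₀ (norm_nonneg _) (norm_nonneg _)).mp h

theorem sRefl_sRefl {α : V} (hα : α ≠ 0) (x : V) : sRefl α (sRefl α x) = x := by
  have h : ⟪α, sRefl α x⟫ = -⟪α, x⟫ := by
    rw [sRefl, inner_sub_right, inner_smul_right, inner_self_coroot hα]
    ring
  rw [sRefl, h, sRefl]
  module

theorem inner_sRefl_coroot {β : V} (hβ : β ≠ 0) (α : V) :
    ⟪sRefl β α, coroot β⟫ = -⟪α, coroot β⟫ := by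
  have : ‖β‖ ≠ 0 := norm_ne_zero_iff.mpr hβ
  simp only [sRefl, coroot, inner_sub_left, inner_smul_left, inner_smul_right, conj_trivial,
    real_inner_comm α β, real_inner_self_eq_norm_sq]
  field_simp
  ring

theorem inner_coroot_sRefl {β : V} (hβ : β ≠ 0) (η α : V) :
    ⟪η, coroot (sRefl β α)⟫ =
      ⟪η, coroot α⟫ - ⟪α, coroot β⟫ * (‖β‖ ^ 2 / ‖α‖ ^ 2) * ⟪η, coroot β⟫ := by
  have : ‖β‖ ≠ 0 := norm_ne_zero_iff.mpr hβ
  rw [inner_coroot, norm_sRefl hβ, sRefl, inner_sub_right, inner_smul_right]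
  simp only [inner_coroot, real_inner_comm α β]
  field_simp

/-- The reflection in the hyperplane orthogonal to a nonzero vector, as a linear equivalence. -/
def sReflEquiv (α : V) (hα : α ≠ 0) : V ≃ₗ[ℝ] V :=
  LinearEquiv.ofInvolutive
    { toFun := sRefl α
      map_add' := fun x y => by simp only [sRefl, inner_add_right]; module
      map_smul' := fun c x => by
        simp only [sRefl, inner_smul_right, RingHom.id_apply]; module }
    (sRefl_sRefl hα)

theorem sReflEquiv_apply (α : V) (hα : α ≠ 0) (v : V) : sReflEquiv α hα v = sRefl α v := rfl

end reflections

section rootSums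

variable {V : Type*} [NormedAddCommGroup V] [InnerProductSpace ℝ V] [FiniteDimensional ℝ V]

theorem IsMultiplicity.apply_sRefl {R : RootSystemBase V} {k : V → ℝ} (hk : IsMultiplicity R k)
    {α β : V} (hα : α ∈ R.roots) (hβ : β ∈ R.roots) : k (sRefl β α) = k α :=
  hk.2 (sReflEquiv β (R.ne_zero β hβ))
    (Subgroup.subset_closure ⟨β, hβ, sReflEquiv_apply β _⟩) α hα

theorem RootSystemBase.sum_sRefl (R : RootSystemBase V) {M : Type*} [AddCommMonoid M] {β : V}
    (hβ : β ∈ R.roots) (f : V → M) :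
    ∑ α ∈ R.roots, f (sRefl β α) = ∑ α ∈ R.roots, f α :=
  Finset.sum_nbij' (sRefl β) (sRefl β) (R.refl_mem β hβ) (R.refl_mem β hβ)
    (fun α _ => sRefl_sRefl (R.ne_zero β hβ) α) (fun α _ => sRefl_sRefl (R.ne_zero β hβ) α)
    (fun _ _ => rfl)

/-- The frame operator of the roots weighted by `w`. -/
def RootSystemBase.frame (R : RootSystemBase V) (w : V → ℝ) : V →ₗ[ℝ] V where
  toFun x := ∑ α ∈ R.roots, (w α * ⟪α, x⟫) • α
  map_add' x y := by
    simp only [inner_add_right, mul_add, add_smul, Finset.sum_add_distrib]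
  map_smul' c x := by
    simp only [inner_smul_right, Finset.smul_sum, RingHom.id_apply, smul_smul]
    exact Finset.sum_congr rfl fun α _ => by congr 1; ring

theorem RootSystemBase.inner_frame (R : RootSystemBase V) (w : V → ℝ) (x y : V) :
    ⟪R.frame w x, y⟫ = ∑ α ∈ R.roots, w α * ⟪α, x⟫ * ⟪α, y⟫ := by
  simp only [RootSystemBase.frame, LinearMap.coe_mk, AddHom.coe_mk, sum_inner, inner_smul_left,
    conj_trivial]

theorem RootSystemBase.inner_frame_comm (R : RootSystemBase V) (w : V → ℝ) (x y : V) :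
    ⟪R.frame w x, y⟫ = ⟪x, R.frame w y⟫ := by
  rw [real_inner_comm (R.frame w y) x, R.inner_frame, R.inner_frame]
  exact Finset.sum_congr rfl fun α _ => by ring

theorem RootSystemBase.exists_frame_root_eq (R : RootSystemBase V) {w : V → ℝ}
    (hw : ∀ α ∈ R.roots, ∀ β ∈ R.roots, w (sRefl β α) = w α) {β : V} (hβ : β ∈ R.roots) :
    ∃ c : ℝ, R.frame w β = c • β := by
  have hβ0 := R.ne_zero β hβ
  have hneg : sRefl β β = -β := by
    have : ‖β‖ ≠ 0 := norm_ne_zero_iff.mpr hβ0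
    rw [sRefl, coroot, smul_smul, real_inner_self_eq_norm_sq]
    have : ‖β‖ ^ 2 * (2 / ‖β‖ ^ 2) = 2 := by field_simp
    rw [this]
    module
  have hinner : ∀ α, ⟪sRefl β α, β⟫ = -⟪α, β⟫ := fun α => by
    have h := inner_sRefl_sRefl hβ0 α β
    rw [hneg, inner_neg_right] at h
    linarith
  have h1 : R.frame w β = -R.frame w β +
      ∑ α ∈ R.roots, (w α * ⟪α, β⟫) • (⟪β, α⟫ • coroot β) := by
    conv_lhs => rw [RootSystemBase.frame, LinearMap.coe_mk, AddHom.coe_mk, ← R.sum_sRefl hβ]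
    simp only [RootSystemBase.frame, LinearMap.coe_mk, AddHom.coe_mk]
    rw [← Finset.sum_neg_distrib, ← Finset.sum_add_distrib]
    refine Finset.sum_congr rfl fun α hα => ?_
    rw [hw α hα β hβ, hinner, sRefl]
    module
  simp only [coroot, smul_smul, ← Finset.sum_smul] at h1
  have h2 := eq_neg_add_iff_add_eq.mp h1
  rw [← two_smul ℝ] at h2
  exact ⟨_, by rw [← inv_smul_smul₀ (two_ne_zero' ℝ) (R.frame w β), h2, smul_smul]⟩

theorem RootSystemBase.exists_frame_eq (R : RootSystemBase V) {w : V → ℝ}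
    (hw : ∀ α ∈ R.roots, ∀ β ∈ R.roots, w (sRefl β α) = w α) :
    ∃ c : ℝ, ∀ x, R.frame w x = c • x := by
  classical
  obtain ⟨β, hβ⟩ := R.roots_nonempty
  obtain ⟨c, hc⟩ := R.exists_frame_root_eq hw hβ
  refine ⟨c, ?_⟩
  have hall : R.roots.filter (fun α => R.frame w α = c • α) = R.roots := by
    refine (R.irreducible _ (Finset.filter_subset _ _) ?_).resolve_left
      (Finset.ne_empty_of_mem (Finset.mem_filter.mpr ⟨hβ, hc⟩))
    intro α hα γ hγ hγ'
    obtain ⟨d, hd⟩ := R.exists_frame_root_eq hw hγ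
    have h := R.inner_frame_comm w α γ
    rw [(Finset.mem_filter.mp hα).2, hd, inner_smul_left, inner_smul_right, conj_trivial] at h
    by_contra hne
    have hcd : c = d := mul_right_cancel₀ hne h
    exact hγ' (Finset.mem_filter.mpr ⟨hγ, hcd ▸ hd⟩)
  have hext : R.frame w = c • LinearMap.id := by
    refine LinearMap.ext_on R.spanning fun α hα => ?_
    rw [← hall] at hα
    exact (Finset.mem_filter.mp hα).2
  intro x
  rw [hext]
  rfl

theorem RootSystemBase.sum_mul_inner_sq (R : RootSystemBase V) {w : V → ℝ}
    (hw : ∀ α ∈ R.roots, ∀ β ∈ R.roots, w (sRefl β α) = w α) (x : V) :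
    (Module.finrank ℝ V : ℝ) * ∑ α ∈ R.roots, w α * ⟪α, x⟫ ^ 2 =
      (∑ α ∈ R.roots, w α * ‖α‖ ^ 2) * ‖x‖ ^ 2 := by
  obtain ⟨c, hc⟩ := R.exists_frame_eq hw
  have hquad : ∀ y, ∑ α ∈ R.roots, w α * ⟪α, y⟫ ^ 2 = c * ‖y‖ ^ 2 := fun y => by
    have h := R.inner_frame w y y
    rw [hc, inner_smul_left, real_inner_self_eq_norm_sq, conj_trivial] at h
    rw [h]
    exact Finset.sum_congr rfl fun α _ => by ring
  have htrace : ∑ α ∈ R.roots, w α * ‖α‖ ^ 2 = Module.finrank ℝ V * c := by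
    let b := stdOrthonormalBasis ℝ V
    have h : ∑ i, ∑ α ∈ R.roots, w α * ⟪α, b i⟫ ^ 2 = ∑ _i : Fin (Module.finrank ℝ V), c := by
      refine Finset.sum_congr rfl fun i _ => ?_
      rw [hquad, b.norm_eq_one]
      ring
    rw [Finset.sum_comm, Finset.sum_const, Finset.card_univ, Fintype.card_fin,
      nsmul_eq_mul] at h
    rw [← h]
    refine Finset.sum_congr rfl fun α _ => ?_
    rw [← Finset.mul_sum, ← b.sum_sq_norm_inner_left α]
    simp only [Real.norm_eq_abs, sq_abs]
  rw [hquad, htrace]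
  ring

end rootSums

section arctan

theorem Real.arctan_sub_arctan_le {x y : ℝ} (h : y ≤ x) :
    Real.arctan x - Real.arctan y ≤ x - y := by
  have hmono : Monotone fun t : ℝ => t - Real.arctan t := by
    refine monotone_of_deriv_nonneg (differentiable_id.sub Real.differentiable_arctan)
      fun t => ?_
    rw [((hasDerivAt_id' t).fun_sub (Real.hasDerivAt_arctan t)).deriv, sub_nonneg,
      div_le_one (by positivity)]
    nlinarith [sq_nonneg t]
  have := hmono h
  simp only at this
  linarith

theorem arctan_increment_mul_mem {k r t : ℝ} (hk : 0 < k) (hr : 0 < r) (ht : 0 ≤ t) (u a : ℝ) :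
    0 ≤ (Real.arctan (u / k) - Real.arctan ((u - a * r * t) / k)) * a ∧
      (Real.arctan (u / k) - Real.arctan ((u - a * r * t) / k)) * a ≤ a ^ 2 * r / k * t := by
  have hdiff : u / k - (u - a * r * t) / k = a * r * t / k := by ring
  have hbound : a ^ 2 * r / k * t = a * r * t / k * a := by ring
  rw [hbound, ← hdiff]
  rcases le_total 0 a with ha | ha
  · have hle : (u - a * r * t) / k ≤ u / k := by
      have : 0 ≤ a * r * t / k := by positivity
      linarith
    exact ⟨mul_nonneg (sub_nonneg.mpr (Real.arctan_strictMono.monotone hle)) ha,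
      mul_le_mul_of_nonneg_right (Real.arctan_sub_arctan_le hle) ha⟩
  · have hle : u / k ≤ (u - a * r * t) / k := by
      have : 0 ≤ -a * r * t / k := by have := neg_nonneg.mpr ha; positivity
      have h : -a * r * t / k = -(a * r * t / k) := by ring
      linarith
    refine ⟨mul_nonneg_of_nonpos_of_nonpos
      (sub_nonpos.mpr (Real.arctan_strictMono.monotone hle)) ha,
      mul_le_mul_of_nonpos_right ?_ ha⟩
    linarith [Real.arctan_sub_arctan_le hle]

end arctan

section sigma

variable {V : Type*} [NormedAddCommGroup V] [InnerProductSpace ℝ V] [FiniteDimensional ℝ V]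

theorem sigmaFun_neg (R : RootSystemBase V) (k : V → ℝ) (η : V) :
    sigmaFun R k (-η) = -sigmaFun R k η := by
  simp only [sigmaFun, inner_neg_left, neg_div, Real.arctan_neg, neg_smul,
    Finset.sum_neg_distrib]

theorem two_mul_inner_sigmaFun_coroot {R : RootSystemBase V} {k : V → ℝ}
    (hk : IsMultiplicity R k) {β : V} (hβ : β ∈ R.roots) (η : V) :
    2 * ⟪sigmaFun R k η, coroot β⟫ = ∑ α ∈ R.roots,
      (Real.arctan (⟪η, coroot α⟫ / k α) -
        Real.arctan ((⟪η, coroot α⟫ -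
          ⟪α, coroot β⟫ * (‖β‖ ^ 2 / ‖α‖ ^ 2) * ⟪η, coroot β⟫) / k α)) * ⟪α, coroot β⟫ := by
  have hβ0 := R.ne_zero β hβ
  have h : ⟪sigmaFun R k η, coroot β⟫ =
      ∑ α ∈ R.roots, Real.arctan (⟪η, coroot α⟫ / k α) * ⟪α, coroot β⟫ := by
    simp only [sigmaFun, sum_inner, inner_smul_left, conj_trivial]
  rw [two_mul]
  nth_rewrite 2 [h]
  rw [← R.sum_sRefl hβ, h, ← Finset.sum_add_distrib]
  refine Finset.sum_congr rfl fun α hα => ?_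
  rw [inner_sRefl_coroot hβ0, inner_coroot_sRefl hβ0, hk.apply_sRefl hα hβ]
  ring

theorem inner_sigmaFun_coroot_nonneg {R : RootSystemBase V} {k : V → ℝ}
    (hk : IsMultiplicity R k) {β : V} (hβ : β ∈ R.roots) {η : V} (hη : 0 ≤ ⟪η, coroot β⟫) :
    0 ≤ ⟪sigmaFun R k η, coroot β⟫ := by
  have h : 0 ≤ 2 * ⟪sigmaFun R k η, coroot β⟫ := by
    rw [two_mul_inner_sigmaFun_coroot hk hβ]
    refine Finset.sum_nonneg fun α hα => (arctan_increment_mul_mem (hk.1 α hα) ?_ hη _ _).1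
    have := norm_pos_iff.mpr (R.ne_zero α hα)
    have := norm_pos_iff.mpr (R.ne_zero β hβ)
    positivity
  linarith

theorem inner_sigmaFun_coroot_le {R : RootSystemBase V} {k : V → ℝ}
    (hk : IsMultiplicity R k) {β : V} (hβ : β ∈ R.roots) {η : V} (hη : 0 ≤ ⟪η, coroot β⟫) :
    ⟪sigmaFun R k η, coroot β⟫ ≤
      (2 * ∑ α ∈ R.roots, (k α)⁻¹) / (Module.finrank ℝ V : ℝ) * ⟪η, coroot β⟫ := by
  have hβn := norm_pos_iff.mpr (R.ne_zero β hβ)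
  have : Nontrivial V := ⟨β, 0, R.ne_zero β hβ⟩
  have hn : (0 : ℝ) < Module.finrank ℝ V := by exact_mod_cast Module.finrank_pos
  have hframe := R.sum_mul_inner_sq (w := fun α => (k α * ‖α‖ ^ 2)⁻¹)
    (fun α hα γ hγ => by rw [hk.apply_sRefl hα hγ, norm_sRefl (R.ne_zero γ hγ)]) β
  have hweight : ∑ α ∈ R.roots, (k α * ‖α‖ ^ 2)⁻¹ * ‖α‖ ^ 2 = ∑ α ∈ R.roots, (k α)⁻¹ :=
    Finset.sum_congr rfl fun α hα => by
      have := norm_pos_iff.mpr (R.ne_zero α hα)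
      have := hk.1 α hα
      field_simp
  rw [hweight] at hframe
  have hsum : ∑ α ∈ R.roots, ⟪α, coroot β⟫ ^ 2 * (‖β‖ ^ 2 / ‖α‖ ^ 2) / k α =
      2 * ((2 * ∑ α ∈ R.roots, (k α)⁻¹) / (Module.finrank ℝ V : ℝ)) := by
    have h : ∑ α ∈ R.roots, ⟪α, coroot β⟫ ^ 2 * (‖β‖ ^ 2 / ‖α‖ ^ 2) / k α =
        4 / ‖β‖ ^ 2 * ∑ α ∈ R.roots, (k α * ‖α‖ ^ 2)⁻¹ * ⟪α, β⟫ ^ 2 := by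
      rw [Finset.mul_sum]
      refine Finset.sum_congr rfl fun α hα => ?_
      have := norm_pos_iff.mpr (R.ne_zero α hα)
      have := hk.1 α hα
      rw [inner_coroot]
      field_simp
      ring
    rw [h]
    generalize ∑ α ∈ R.roots, (k α * ‖α‖ ^ 2)⁻¹ * ⟪α, β⟫ ^ 2 = q at hframe ⊢
    generalize ∑ α ∈ R.roots, (k α)⁻¹ = s at hframe ⊢
    field_simp
    linear_combination 4 * hframe
  have h : 2 * ⟪sigmaFun R k η, coroot β⟫ ≤
      2 * ((2 * ∑ α ∈ R.roots, (k α)⁻¹) / (Module.finrank ℝ V : ℝ)) * ⟪η, coroot β⟫ := by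
    rw [two_mul_inner_sigmaFun_coroot hk hβ, ← hsum, Finset.sum_mul]
    refine Finset.sum_le_sum fun α hα => (arctan_increment_mul_mem (hk.1 α hα) ?_ hη _ _).2
    have := norm_pos_iff.mpr (R.ne_zero α hα)
    positivity
  linarith

end sigma

/-- For every dominant weight `μ ∈ P⁺` and `β ∈ Σ₀⁺`:
`2πμ(β∨)/(1 + h_k/n) ≤ μ̂_k(β∨) ≤ 2πμ(β∨)` with `h_k = 2 Σ_{α∈Σ₀} 1/k_α`, `n = dim V`. -/
theorem statement8
    {V : Type*} [NormedAddCommGroup V] [InnerProductSpace ℝ V] [FiniteDimensional ℝ V]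
    (R : RootSystemBase V) (k : V → ℝ) (hk : IsMultiplicity R k)
    (hat : V → V)
    (hhat : ∀ μ : V, IsWeight R μ →
      hat μ + sigmaFun R k (hat μ) = (2 * Real.pi) • μ)
    (μ : V) (hμ : IsWeight R μ) (hdom : ∀ β ∈ R.pos, 0 ≤ ⟪μ, coroot β⟫)
    (β : V) (hβ : β ∈ R.pos) :
    2 * Real.pi * ⟪μ, coroot β⟫ /
        (1 + (2 * ∑ α ∈ R.roots, (k α)⁻¹) / (Module.finrank ℝ V : ℝ)) ≤
      ⟪hat μ, coroot β⟫ ∧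
    ⟪hat μ, coroot β⟫ ≤ 2 * Real.pi * ⟪μ, coroot β⟫ := by
  have hβ' := R.pos_sub hβ
  have heq : ⟪hat μ, coroot β⟫ + ⟪sigmaFun R k (hat μ), coroot β⟫ =
      2 * Real.pi * ⟪μ, coroot β⟫ := by
    rw [← inner_add_left, hhat μ hμ, inner_smul_left, conj_trivial]
  have hμβ : 0 ≤ 2 * Real.pi * ⟪μ, coroot β⟫ := mul_nonneg Real.two_pi_pos.le (hdom β hβ)
  have hη : 0 ≤ ⟪hat μ, coroot β⟫ := by
    by_contra! hneg
    have h := inner_sigmaFun_coroot_nonneg hk hβ' (η := -hat μ)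
      (by rw [inner_neg_left]; linarith)
    rw [sigmaFun_neg, inner_neg_left] at h
    linarith
  have hk0 : 0 ≤ (2 * ∑ α ∈ R.roots, (k α)⁻¹) / (Module.finrank ℝ V : ℝ) := by
    have : 0 ≤ ∑ α ∈ R.roots, (k α)⁻¹ :=
      Finset.sum_nonneg fun α hα => (inv_pos.mpr (hk.1 α hα)).le
    positivity
  constructor
  · rw [div_le_iff₀ (by linarith)]
    linarith [inner_sigmaFun_coroot_le hk hβ' hη]
  · linarith [inner_sigmaFun_coroot_nonneg hk hβ' hη]

end
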